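/- Let d ≥ 2 be an integer and let r, δ ∈ ℝ satisfy δ > 1, r ≤ 1, and d ≥ 4δ − 2r − 2. Then there exists a constant C > 0 such that for all measurable F, G, H : ℝ^d → [0,∞) with finite L² norms, I₁(F, G, H) ≤ C ‖F‖_{L²} ‖G‖_{L²} ‖H‖_{L²}. -/

import Mathlib

open MeasureTheory

/-- The function `μ_{r,δ}(ξ) = (|ξ₁| + |ξ|^δ)/|ξ|^r`. -/
noncomputable def muW (d : ℕ) (hd : 0 < d) (r δ : ℝ)
    (ξ : EuclideanSpace ℝ (Fin d)) : ℝ :=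
  (|ξ ⟨0, hd⟩| + ‖ξ‖ ^ δ) / ‖ξ‖ ^ r

/-- The region `E₁ ⊆ B(0,1)²` where `|ξ| + |η| > 3||ξ| - |η||`. -/
def E1set (d : ℕ) : Set (EuclideanSpace ℝ (Fin d) × EuclideanSpace ℝ (Fin d)) :=
  {p | ‖p.1‖ < 1 ∧ ‖p.2‖ < 1 ∧ 3 * |‖p.1‖ - ‖p.2‖| < ‖p.1‖ + ‖p.2‖}

/-- The trilinear functional `I₁(F,G,H)` restricted to `E₁`. -/
noncomputable def I1tri (d : ℕ) (hd : 0 < d) (r δ : ℝ)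
    (F G H : EuclideanSpace ℝ (Fin d) → ℝ) : ENNReal :=
  ∫⁻ p in E1set d,
    ENNReal.ofReal (muW d hd r δ (p.1 + p.2) / (muW d hd r δ p.1 * muW d hd r δ p.2)) *
      ENNReal.ofReal (F p.1) * ENNReal.ofReal (G p.2) * ENNReal.ofReal (H (p.1 + p.2))

theorem lintegral_inv_abs_add_sq_le {a : ℝ} (ha : 0 < a) :
    ∫⁻ t : ℝ, ENNReal.ofReal ((|t| + a)⁻¹ ^ 2) ≤ ENNReal.ofReal (Real.pi / a) := by
  have hint : Integrable fun t : ℝ => (a ^ 2)⁻¹ * (1 + (t / a) ^ 2)⁻¹ :=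
    (integrable_inv_one_add_sq.comp_div ha.ne').const_mul _
  calc ∫⁻ t : ℝ, ENNReal.ofReal ((|t| + a)⁻¹ ^ 2)
      ≤ ∫⁻ t : ℝ, ENNReal.ofReal ((a ^ 2)⁻¹ * (1 + (t / a) ^ 2)⁻¹) := by
        refine lintegral_mono fun t => ENNReal.ofReal_le_ofReal ?_
        rw [← mul_inv, inv_pow]
        have h : a ^ 2 * (1 + (t / a) ^ 2) = a ^ 2 + |t| ^ 2 := by
          rw [sq_abs]; field_simp
        rw [h]
        have := abs_nonneg t
        exact inv_anti₀ (by positivity) (by nlinarith [mul_nonneg this ha.le])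
    _ = ENNReal.ofReal (∫ t : ℝ, (a ^ 2)⁻¹ * (1 + (t / a) ^ 2)⁻¹) :=
        (ofReal_integral_eq_lintegral_ofReal hint (ae_of_all _ fun t => by positivity)).symm
    _ = ENNReal.ofReal (Real.pi / a) := by
        rw [integral_const_mul, Measure.integral_comp_div (fun t : ℝ => (1 + t ^ 2)⁻¹) a,
          integral_univ_inv_one_add_sq, abs_of_pos ha, smul_eq_mul]
        congr 1
        field_simp

theorem setLIntegral_closedBall_inv_abs_add_sq_le (n : ℕ) {a R : ℝ} (ha : 0 < a) (hR : 0 ≤ R) :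
    ∫⁻ x in Metric.closedBall (0 : EuclideanSpace ℝ (Fin (n + 1))) R,
        ENNReal.ofReal ((|x 0| + a)⁻¹ ^ 2) ≤
      ENNReal.ofReal (Real.pi / a * (2 * R) ^ n) := by
  let φ : ℝ → ENNReal := fun t => ENNReal.ofReal ((|t| + a)⁻¹ ^ 2)
  let ψ : (Fin n → ℝ) → ENNReal := (Metric.closedBall 0 R).indicator 1
  have hφ : Measurable φ := by fun_prop
  have hψ : Measurable ψ := measurable_one.indicator measurableSet_closedBall
  have hmp := (volume_preserving_piFinSuccAbove (fun _ : Fin (n + 1) => ℝ) 0).comp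
    (PiLp.volume_preserving_ofLp (Fin (n + 1)))
  rw [← lintegral_indicator measurableSet_closedBall]
  calc _ ≤ ∫⁻ x : EuclideanSpace ℝ (Fin (n + 1)),
          φ (x 0) * ψ (fun i => x i.succ) := by
        refine lintegral_mono fun x => ?_
        by_cases hx : x ∈ Metric.closedBall (0 : EuclideanSpace ℝ (Fin (n + 1))) R
        · have hmem : (fun i : Fin n => x i.succ) ∈ Metric.closedBall (0 : Fin n → ℝ) R := by
            rw [mem_closedBall_zero_iff] at hx ⊢
            exact (pi_norm_le_iff_of_nonneg hR).2 fun i =>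
              (PiLp.norm_apply_le x i.succ).trans hx
          simp only [ψ, φ]
          rw [Set.indicator_of_mem hx, Set.indicator_of_mem hmem]
          simp
        · rw [Set.indicator_of_notMem hx]
          exact zero_le
    _ = ∫⁻ y : ℝ × (Fin n → ℝ), φ y.1 * ψ y.2 :=
        hmp.lintegral_comp (f := fun y : ℝ × (Fin n → ℝ) => φ y.1 * ψ y.2)
          ((hφ.comp measurable_fst).mul (hψ.comp measurable_snd))
    _ = (∫⁻ t, φ t) * ∫⁻ z, ψ z := lintegral_prod_mul hφ.aemeasurable hψ.aemeasurable
    _ ≤ ENNReal.ofReal (Real.pi / a) * ENNReal.ofReal ((2 * R) ^ n) := by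
        refine mul_le_mul' (lintegral_inv_abs_add_sq_le ha) (le_of_eq ?_)
        rw [lintegral_indicator_one measurableSet_closedBall, Real.volume_pi_closedBall _ hR]
        simp
    _ = _ := (ENNReal.ofReal_mul (by positivity)).symm

theorem lintegral_trilinear_le {E : Type*} [NormedAddCommGroup E] [MeasurableSpace E]
    [BorelSpace E] [SecondCountableTopology E] (μ : Measure E) [SFinite μ]
    [μ.IsAddLeftInvariant] {k : E × E → ENNReal} (hk : Measurable k) {A : ENNReal}
    (hA : ∀ η, ∫⁻ ξ, k (ξ, η) ^ 2 ∂μ ≤ A) {f g h : E → ENNReal}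
    (hf : Measurable f) (hg : Measurable g) (hh : Measurable h) :
    ∫⁻ p, k p * f p.1 * g p.2 * h (p.1 + p.2) ∂(μ.prod μ) ≤
      A ^ (1 / 2 : ℝ) * ((∫⁻ ξ, f ξ ^ 2 ∂μ) ^ (1 / 2 : ℝ) *
        ((∫⁻ ξ, g ξ ^ 2 ∂μ) ^ (1 / 2 : ℝ) * (∫⁻ ξ, h ξ ^ 2 ∂μ) ^ (1 / 2 : ℝ))) := by
  have hu : Measurable fun p : E × E => k p * g p.2 := by fun_prop
  have hv : Measurable fun p : E × E => f p.1 * h (p.1 + p.2) := by fun_prop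
  have hold := ENNReal.lintegral_mul_le_Lp_mul_Lq (μ.prod μ) Real.HolderConjugate.two_two
    hu.aemeasurable hv.aemeasurable
  have h1 : ∫⁻ p, (k p * g p.2) ^ (2 : ℝ) ∂(μ.prod μ) ≤ A * ∫⁻ ξ, g ξ ^ 2 ∂μ := by
    rw [lintegral_prod_symm' _ (hu.pow_const _), ← lintegral_const_mul _ (hg.pow_const 2)]
    refine lintegral_mono fun η => ?_
    simp only [ENNReal.rpow_two, mul_pow]
    rw [lintegral_mul_const _ (by fun_prop)]
    exact mul_le_mul_left (hA η) _
  have h2 : ∫⁻ p, (f p.1 * h (p.1 + p.2)) ^ (2 : ℝ) ∂(μ.prod μ) =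
      (∫⁻ ξ, f ξ ^ 2 ∂μ) * ∫⁻ ξ, h ξ ^ 2 ∂μ := by
    rw [lintegral_prod _ (hv.pow_const _).aemeasurable, ← lintegral_mul_const _ (hf.pow_const 2)]
    refine lintegral_congr fun ξ => ?_
    simp only [ENNReal.rpow_two, mul_pow]
    rw [lintegral_const_mul _ (by fun_prop),
      lintegral_add_left_eq_self (fun η => h η ^ 2) ξ]
  calc ∫⁻ p, k p * f p.1 * g p.2 * h (p.1 + p.2) ∂(μ.prod μ)
      = ∫⁻ p, ((fun p : E × E => k p * g p.2) * fun p : E × E => f p.1 * h (p.1 + p.2)) p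
          ∂(μ.prod μ) := lintegral_congr fun p => by simp only [Pi.mul_apply]; ring
    _ ≤ _ := hold
    _ ≤ (A * ∫⁻ ξ, g ξ ^ 2 ∂μ) ^ (1 / 2 : ℝ) *
          ((∫⁻ ξ, f ξ ^ 2 ∂μ) * ∫⁻ ξ, h ξ ^ 2 ∂μ) ^ (1 / 2 : ℝ) := by
        rw [h2]
        gcongr
    _ = _ := by
        rw [ENNReal.mul_rpow_of_nonneg _ _ (by norm_num), ENNReal.mul_rpow_of_nonneg _ _ (by norm_num)]
        ring

theorem muW_nonneg (d : ℕ) (hd : 0 < d) (r δ : ℝ) (ξ : EuclideanSpace ℝ (Fin d)) :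
    0 ≤ muW d hd r δ ξ := by
  unfold muW; positivity

theorem measurable_muW (d : ℕ) (hd : 0 < d) (r δ : ℝ) : Measurable (muW d hd r δ) := by
  unfold muW; fun_prop

theorem measurableSet_E1set (d : ℕ) : MeasurableSet (E1set d) := by
  unfold E1set
  measurability

theorem muW_le_of_norm_le_two {d : ℕ} (hd : 0 < d) {r δ : ℝ} (hδ : 1 < δ)
    {ζ : EuclideanSpace ℝ (Fin d)} (hζ : ‖ζ‖ ≤ 2) (hζ₀ : ζ ≠ 0) :
    muW d hd r δ ζ ≤ (1 + 2 ^ (δ - 1)) * ‖ζ‖ ^ (1 - r) := by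
  have h0 : 0 < ‖ζ‖ := norm_pos_iff.2 hζ₀
  have hδ' : ‖ζ‖ ^ δ ≤ 2 ^ (δ - 1) * ‖ζ‖ := by
    calc ‖ζ‖ ^ δ = ‖ζ‖ ^ (δ - 1) * ‖ζ‖ := by
          rw [← Real.rpow_add_one h0.ne', sub_add_cancel]
      _ ≤ _ := by
          gcongr
  have h1 : |ζ ⟨0, hd⟩| ≤ ‖ζ‖ := PiLp.norm_apply_le ζ ⟨0, hd⟩
  rw [Real.rpow_sub h0, Real.rpow_one, mul_div_assoc', muW]
  gcongr
  linarith

theorem muW_div_le_of_mem_E1set {d : ℕ} (hd : 0 < d) {r δ : ℝ} (hδ : 1 < δ) (hr : r ≤ 1)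
    {ξ η : EuclideanSpace ℝ (Fin d)} (h : (ξ, η) ∈ E1set d) :
    muW d hd r δ (ξ + η) / (muW d hd r δ ξ * muW d hd r δ η) ≤
      ((1 + 2 ^ (δ - 1)) * 3 ^ (1 - r) * 2 ^ |r|) * ‖η‖ ^ (1 + r - δ) *
        (|ξ ⟨0, hd⟩| + (‖η‖ / 2) ^ δ)⁻¹ := by
  obtain ⟨hξ1, hη1, habs⟩ := h
  simp only at hξ1 hη1 habs
  have hl := neg_abs_le (‖ξ‖ - ‖η‖)
  have hu := le_abs_self (‖ξ‖ - ‖η‖)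
  have hN : 0 < ‖η‖ := by linarith
  have hx : 0 < ‖ξ‖ := by linarith
  have hx2 : ‖ξ‖ ≤ 2 * ‖η‖ := by linarith
  have hx3 : ‖η‖ / 2 ≤ ‖ξ‖ := by linarith
  have hsum := norm_add_le ξ η
  have hnum : muW d hd r δ (ξ + η) ≤ (1 + 2 ^ (δ - 1)) * 3 ^ (1 - r) * ‖η‖ ^ (1 - r) := by
    by_cases hz : ξ + η = 0
    · rw [hz]
      simp only [muW, PiLp.zero_apply, abs_zero, norm_zero,
        Real.zero_rpow (by linarith : δ ≠ 0), add_zero, zero_div]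
      positivity
    · refine (muW_le_of_norm_le_two hd hδ (by linarith) hz).trans ?_
      rw [mul_assoc, ← Real.mul_rpow (by norm_num) hN.le]
      gcongr
      linarith
  have hr2 : ‖ξ‖ ^ r ≤ 2 ^ |r| * ‖η‖ ^ r := by
    rcases le_total 0 r with h0 | h0
    · rw [abs_of_nonneg h0, ← Real.mul_rpow (by norm_num) hN.le]
      gcongr
    · rw [abs_of_nonpos h0]
      refine (Real.rpow_le_rpow_of_nonpos (by positivity) hx3 h0).trans_eq ?_
      rw [Real.div_rpow hN.le (by norm_num), Real.rpow_neg (by norm_num), div_eq_inv_mul]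
  have hξinv : (muW d hd r δ ξ)⁻¹ ≤
      2 ^ |r| * ‖η‖ ^ r * (|ξ ⟨0, hd⟩| + (‖η‖ / 2) ^ δ)⁻¹ := by
    rw [muW, inv_div, div_eq_mul_inv]
    gcongr
  have hηinv : (muW d hd r δ η)⁻¹ ≤ ‖η‖ ^ (r - δ) := by
    rw [muW, inv_div, Real.rpow_sub hN]
    gcongr
    exact le_add_of_nonneg_left (abs_nonneg _)
  rw [div_eq_mul_inv, mul_inv]
  calc _ ≤ ((1 + 2 ^ (δ - 1)) * 3 ^ (1 - r) * ‖η‖ ^ (1 - r)) *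
        ((2 ^ |r| * ‖η‖ ^ r * (|ξ ⟨0, hd⟩| + (‖η‖ / 2) ^ δ)⁻¹) * ‖η‖ ^ (r - δ)) := by
        have := muW_nonneg d hd r δ ξ
        have := muW_nonneg d hd r δ η
        gcongr
    _ = _ := by
        rw [show 1 + r - δ = (1 - r) + r + (r - δ) by ring, Real.rpow_add hN, Real.rpow_add hN]
        ring

/-- An upper bound for the squared norms of the slices of the kernel of `I1tri`. -/
noncomputable def kernelBound (n : ℕ) (r δ : ℝ) : ℝ :=
  ((1 + 2 ^ (δ - 1)) * 3 ^ (1 - r) * 2 ^ |r|) ^ 2 * (Real.pi * 4 ^ n * 2 ^ δ)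

theorem lintegral_kernel_sq_le {n : ℕ} {r δ : ℝ} (hδ : 1 < δ) (hr : r ≤ 1)
    (hdim : 4 * δ - 2 * r - 2 ≤ n + 1) (η : EuclideanSpace ℝ (Fin (n + 1))) :
    ∫⁻ ξ, (E1set (n + 1)).indicator (fun p => ENNReal.ofReal
        (muW (n + 1) n.succ_pos r δ (p.1 + p.2) /
          (muW (n + 1) n.succ_pos r δ p.1 * muW (n + 1) n.succ_pos r δ p.2))) (ξ, η) ^ 2 ≤
      ENNReal.ofReal (kernelBound n r δ) := by
  set c : ℝ := (1 + 2 ^ (δ - 1)) * 3 ^ (1 - r) * 2 ^ |r| with hc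
  have hc0 : 0 ≤ c := by positivity
  by_cases hη : 0 < ‖η‖ ∧ ‖η‖ < 1
  swap
  · refine (lintegral_eq_zero_of_ae_eq_zero (ae_of_all _ fun ξ => ?_)).trans_le zero_le
    have hnm : (ξ, η) ∉ E1set (n + 1) := by
      rintro ⟨-, h1, h2⟩
      simp only at h1 h2
      exact hη ⟨by linarith [neg_abs_le (‖ξ‖ - ‖η‖), le_abs_self (‖ξ‖ - ‖η‖)], h1⟩
    simp [Set.indicator_of_notMem hnm]
  obtain ⟨hN, hN1⟩ := hη
  set b : ℝ := c * ‖η‖ ^ (1 + r - δ) with hb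
  have hb0 : 0 ≤ b := by positivity
  have ha : 0 < (‖η‖ / 2) ^ δ := by positivity
  calc _ ≤ ∫⁻ ξ, (Metric.closedBall (0 : EuclideanSpace ℝ (Fin (n + 1))) (2 * ‖η‖)).indicator
          (fun ξ => ENNReal.ofReal (b ^ 2) *
            ENNReal.ofReal ((|ξ 0| + (‖η‖ / 2) ^ δ)⁻¹ ^ 2)) ξ := by
        refine lintegral_mono fun ξ => ?_
        by_cases hm : (ξ, η) ∈ E1set (n + 1)
        · have hball : ξ ∈ Metric.closedBall (0 : EuclideanSpace ℝ (Fin (n + 1))) (2 * ‖η‖) := by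
            rw [mem_closedBall_zero_iff]
            have := hm.2.2
            simp only at this
            linarith [le_abs_self (‖ξ‖ - ‖η‖)]
          rw [Set.indicator_of_mem hm, Set.indicator_of_mem hball,
            ← ENNReal.ofReal_mul (by positivity), ← mul_pow, ENNReal.ofReal_pow (by positivity)]
          gcongr
          exact muW_div_le_of_mem_E1set n.succ_pos hδ hr hm
        · rw [Set.indicator_of_notMem hm]
          simp
    _ ≤ ENNReal.ofReal (b ^ 2) *
          ENNReal.ofReal (Real.pi / (‖η‖ / 2) ^ δ * (2 * (2 * ‖η‖)) ^ n) := by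
        rw [lintegral_indicator measurableSet_closedBall, lintegral_const_mul _ (by fun_prop)]
        gcongr
        exact setLIntegral_closedBall_inv_abs_add_sq_le n ha (by positivity)
    _ ≤ _ := by
        rw [← ENNReal.ofReal_mul (by positivity)]
        refine ENNReal.ofReal_le_ofReal ?_
        have hpow : ‖η‖ ^ (2 * (1 + r - δ) + n - δ) ≤ 1 :=
          Real.rpow_le_one hN.le hN1.le (by linarith)
        have hexp : ‖η‖ ^ (2 * (1 + r - δ) + n - δ) =
            (‖η‖ ^ (1 + r - δ)) ^ 2 * ‖η‖ ^ n / ‖η‖ ^ δ := by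
          rw [Real.rpow_sub hN, Real.rpow_add hN, Real.rpow_natCast, mul_comm (2 : ℝ),
            Real.rpow_mul hN.le, Real.rpow_two]
        calc b ^ 2 * (Real.pi / (‖η‖ / 2) ^ δ * (2 * (2 * ‖η‖)) ^ n)
            = kernelBound n r δ * ‖η‖ ^ (2 * (1 + r - δ) + n - δ) := by
              rw [hexp, hb, kernelBound, ← hc, Real.div_rpow hN.le (by norm_num), ← mul_assoc 2 2,
                mul_pow (2 * 2 : ℝ)]
              norm_num
              field_simp
          _ ≤ kernelBound n r δ := mul_le_of_le_one_right (by unfold kernelBound; positivity) hpow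

theorem stmt13 (d : ℕ) (hd : 2 ≤ d) (r δ : ℝ) (hδ : 1 < δ)
    (hr : r ≤ 1) (hdim : 4 * δ - 2 * r - 2 ≤ (d : ℝ)) :
    ∃ C : ℝ, 0 < C ∧ ∀ F G H : EuclideanSpace ℝ (Fin d) → ℝ,
      Measurable F → (∀ ξ, 0 ≤ F ξ) → Measurable G → (∀ ξ, 0 ≤ G ξ) →
      Measurable H → (∀ ξ, 0 ≤ H ξ) →
      (∫⁻ ξ, ENNReal.ofReal (F ξ) ^ 2) < ⊤ →
      (∫⁻ ξ, ENNReal.ofReal (G ξ) ^ 2) < ⊤ →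
      (∫⁻ ξ, ENNReal.ofReal (H ξ) ^ 2) < ⊤ →
      I1tri d (by omega) r δ F G H ≤
        ENNReal.ofReal C * ((∫⁻ ξ, ENNReal.ofReal (F ξ) ^ 2) ^ (1/2 : ℝ) *
          ((∫⁻ ξ, ENNReal.ofReal (G ξ) ^ 2) ^ (1/2 : ℝ) *
           (∫⁻ ξ, ENNReal.ofReal (H ξ) ^ 2) ^ (1/2 : ℝ))) := by
  obtain ⟨n, rfl⟩ : ∃ n, d = n + 1 := ⟨d - 1, by omega⟩
  push_cast at hdim
  have hpos : 0 < kernelBound n r δ := by unfold kernelBound; positivity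
  refine ⟨kernelBound n r δ ^ (1 / 2 : ℝ), by positivity, ?_⟩
  intro F G H hF _ hG _ hH _ _ _ _
  have hμ := measurable_muW (n + 1) n.succ_pos r δ
  have hk : Measurable ((E1set (n + 1)).indicator fun p => ENNReal.ofReal
      (muW (n + 1) n.succ_pos r δ (p.1 + p.2) /
        (muW (n + 1) n.succ_pos r δ p.1 * muW (n + 1) n.succ_pos r δ p.2))) :=
    Measurable.indicator (by fun_prop) (measurableSet_E1set _)
  rw [← ENNReal.ofReal_rpow_of_pos hpos]
  refine le_trans (le_of_eq ?_) (lintegral_trilinear_le volume hk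
    (lintegral_kernel_sq_le hδ hr hdim) hF.ennreal_ofReal hG.ennreal_ofReal hH.ennreal_ofReal)
  rw [I1tri, ← lintegral_indicator (measurableSet_E1set _), Measure.volume_eq_prod]
  refine lintegral_congr fun p => ?_
  by_cases hp : p ∈ E1set (n + 1)
  · simp only [Set.indicator_of_mem hp]
  · simp only [Set.indicator_of_notMem hp, zero_mul]
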